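/- Let D be a finite set, d ≥ 1, g_i ∈ ℝ^d with g_i ≠ 0 for all i ∈ D, α > 0, and let F(S) = log det(I + α F_S) with F_S = ∑_{y∈S} g_y g_yᵀ be the Fisher utility. Suppose there exist G_max > 0 and ρ ∈ (0,1) with ‖g_x‖ ≤ G_max for all x, with α‖F_S‖ ≤ ρ for every S ⊆ D, and with 1 − ρ − α G_max² ρ > 0; set C = 1/(1 − ρ − α G_max² ρ) and ĉ = max_{x∈D} [C α² ∑_{y≠x} (g_xᵀ g_y)²] / [(1 + α‖g_x‖²) · log(1 + α‖g_x‖²)]. If 0 < ĉ ≤ 1, then the greedy solution S_greedy with budget k satisfies F(S_greedy) ≥ ((1 − e^{−ĉ})/ĉ) · F(S*), where S* is any subset with |S*| ≤ k maximizing F. -/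

import Mathlib

open Matrix Finset

/-- Fisher matrix `F_S = ∑_{y∈S} g_y g_yᵀ`. -/
noncomputable def fisherMatrix {ι : Type*} [DecidableEq ι] {d : ℕ}
    (g : ι → (Fin d → ℝ)) (S : Finset ι) : Matrix (Fin d) (Fin d) ℝ :=
  ∑ y ∈ S, vecMulVec (g y) (g y)

/-- Fisher utility `F(S) = log det (I + α F_S)`. -/
noncomputable def fisherUtility {ι : Type*} [DecidableEq ι] {d : ℕ}
    (g : ι → (Fin d → ℝ)) (α : ℝ) (S : Finset ι) : ℝ :=
  Real.log ((1 + α • fisherMatrix g S).det)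

/-- Operator (spectral) norm of a matrix, as the norm of the induced map on
Euclidean space. -/
noncomputable def matOpNorm {d : ℕ} (A : Matrix (Fin d) (Fin d) ℝ) : ℝ :=
  ‖Matrix.toEuclideanCLM (𝕜 := ℝ) A‖

/-- Bernoulli's inequality in the form `1 - c ≤ (1 - c / n) ^ r` for `r ≤ n`. -/
theorem one_sub_le_one_sub_div_pow {c : ℝ} (hc0 : 0 ≤ c) (hc1 : c ≤ 1) {r n : ℕ} (hrn : r ≤ n) :
    1 - c ≤ (1 - c / n) ^ r := by
  rcases Nat.eq_zero_or_pos n with rfl | hn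
  · obtain rfl : r = 0 := by omega
    simpa using hc0
  have hn' : (1 : ℝ) ≤ n := by exact_mod_cast hn
  have hcn : c / n ≤ 1 := (div_le_one (by linarith)).2 (by linarith)
  have hr : (r : ℝ) ≤ n := by exact_mod_cast hrn
  have h := one_add_mul_le_pow (a := -(c / n)) (by linarith) r
  have hmul : (r : ℝ) * (c / n) ≤ c := by
    rw [← mul_div_assoc, div_le_iff₀ (by linarith)]
    nlinarith
  rw [← sub_eq_add_neg] at h
  linarith

theorem mul_one_sub_div_pow_add_le {c : ℝ} (hc0 : 0 ≤ c) (hc1 : c ≤ 1) {r m : ℕ} (hrm : r ≤ m) :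
    m * (1 - c / m) ^ r + (1 - c) ≤ (m + 1) * (1 - c / (m + 1)) ^ (r + 1) := by
  have hm0 : (0 : ℝ) ≤ m := Nat.cast_nonneg m
  have hB : ((m : ℝ) + 1) * (1 - c / (m + 1)) = m + 1 - c := by field_simp
  induction r with
  | zero => simp only [pow_zero, zero_add, pow_one, hB]; linarith
  | succ r ih =>
    have hm : (0 : ℝ) < m := by exact_mod_cast (by omega : 0 < m)
    have hA := one_sub_le_one_sub_div_pow hc0 hc1 (show r ≤ m by omega)
    have hB0 : 0 ≤ 1 - c / ((m : ℝ) + 1) := by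
      rw [sub_nonneg, div_le_one (by linarith)]; linarith
    have h := mul_le_mul_of_nonneg_right (ih (by omega)) hB0
    have hdiff : (m : ℝ) * (1 - c / (m + 1)) = m * (1 - c / m) + c / (m + 1) := by
      field_simp; ring
    have hcm : 0 ≤ c / ((m : ℝ) + 1) := by positivity
    have hkey := mul_le_mul_of_nonneg_left hA hcm
    calc m * (1 - c / m) ^ (r + 1) + (1 - c)
        ≤ (m * (1 - c / m) ^ r + (1 - c)) * (1 - c / (m + 1)) := by
          have : (m * (1 - c / m) ^ r + (1 - c)) * (1 - c / (m + 1))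
              = (1 - c / m) ^ r * (m * (1 - c / (m + 1))) + (1 - c) * (1 - c / (m + 1)) := by ring
          rw [this, hdiff, pow_succ]
          linarith
      _ ≤ _ := by rw [pow_succ _ (r + 1), ← mul_assoc]; exact h

section Curvature

variable {ι : Type*} [DecidableEq ι] {F : Finset ι → ℝ}

theorem sub_le_card_sdiff_mul_of_submodular
    (hsub : ∀ A B : Finset ι, A ⊆ B → ∀ x ∉ B, F (insert x B) - F B ≤ F (insert x A) - F A)
    (A T : Finset ι) (hT : Disjoint T A) (δ : ℝ) (hδ : ∀ y ∉ A, F (insert y A) - F A ≤ δ) :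
    F (T ∪ A) - F A ≤ #T * δ := by
  induction T using Finset.induction_on with
  | empty => simp
  | insert a T ha ih =>
    rw [disjoint_insert_left] at hT
    have h1 := ih hT.2
    have h2 := hsub A (T ∪ A) subset_union_right a (by simp [ha, hT.1])
    have h3 := hδ a hT.1
    rw [insert_union, card_insert_of_notMem ha]
    push_cast
    linarith

/-- Progress of the greedy algorithm from step `t` on, for a monotone submodular function of
total curvature at most `c`. -/
theorem greedy_progress_of_curvature [Fintype ι] {c : ℝ} (hc0 : 0 ≤ c) (hc1 : c ≤ 1)
    (hF0 : F ∅ = 0)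
    (hsub : ∀ A B : Finset ι, A ⊆ B → ∀ x ∉ B, F (insert x B) - F B ≤ F (insert x A) - F A)
    (hmono : ∀ A : Finset ι, ∀ x ∉ A, 0 ≤ F (insert x A) - F A)
    (hcurv : ∀ x, (1 - c) * F {x} ≤ F univ - F (univ.erase x))
    {k : ℕ} {S : ℕ → Finset ι}
    (hgreedy : ∀ t < k, ∃ x ∉ S t, S (t + 1) = insert x (S t) ∧
      ∀ y ∉ S t, F (insert y (S t)) - F (S t) ≤ F (insert x (S t)) - F (S t))
    (Ω : Finset ι) (r n t : ℕ) (htr : t + r = k) (hrn : r ≤ n) (hn : #(Ω \ S t) ≤ n) :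
    (F (Ω ∪ S t) - F (S t)) * (1 - (1 - c / n) ^ r) ≤ c * (F (S k) - F (S t)) := by
  induction r generalizing n t with
  | zero =>
    obtain rfl : t = k := by omega
    simp
  | succ r ih =>
    obtain ⟨m, rfl⟩ : ∃ m, n = m + 1 := ⟨n - 1, by omega⟩
    obtain ⟨x, hx, hS, hmax⟩ := hgreedy t (by omega)
    have hm0 : (0 : ℝ) ≤ m := Nat.cast_nonneg m
    have hgain := hmono (S t) x hx
    set δ := F (insert x (S t)) - F (S t) with hδ
    have hXle : F (Ω ∪ S t) - F (S t) ≤ (m + 1) * δ := by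
      have h := sub_le_card_sdiff_mul_of_submodular hsub (S t) (Ω \ S t) sdiff_disjoint δ hmax
      rw [sdiff_union_self_eq_union] at h
      have : (#(Ω \ S t) : ℝ) ≤ m + 1 := by exact_mod_cast hn
      nlinarith
    have hB0 : 0 ≤ 1 - c / ((m : ℝ) + 1) := by
      rw [sub_nonneg, div_le_one (by linarith)]; linarith
    have hB1 : 1 - c / ((m : ℝ) + 1) ≤ 1 := by
      have : 0 ≤ c / ((m : ℝ) + 1) := by positivity
      linarith
    push_cast
    by_cases hxΩ : x ∈ Ω
    · have hunion : Ω ∪ S (t + 1) = Ω ∪ S t := by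
        rw [hS, union_insert, insert_eq_of_mem (mem_union_left _ hxΩ)]
      have hcard : #(Ω \ S (t + 1)) ≤ m := by
        have : Ω \ S (t + 1) = (Ω \ S t).erase x := by rw [hS, sdiff_insert]
        rw [this, card_erase_of_mem (by simp [hx, hxΩ])]
        omega
      have h := ih m (t + 1) (by omega) (by omega) hcard
      rw [hunion, hS] at h
      have hX0 : 0 ≤ F (Ω ∪ S t) - F (S t) := by
        have key : ∀ T : Finset ι, F (S t) ≤ F (T ∪ S t) := by
          intro T
          induction T using Finset.induction_on with
          | empty => simp
          | insert a T ha ihT =>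
            rw [insert_union]
            by_cases haT : a ∈ T ∪ S t
            · rwa [insert_eq_of_mem haT]
            · linarith [hmono _ a haT]
        linarith [key Ω]
      have hA := one_sub_le_one_sub_div_pow hc0 hc1 (show r ≤ m by omega)
      have hmain := mul_one_sub_div_pow_add_le hc0 hc1 (show r ≤ m by omega)
      set X := F (Ω ∪ S t) - F (S t)
      set a := (1 - c / (m : ℝ)) ^ r
      set b := (1 - c / ((m : ℝ) + 1)) ^ (r + 1)
      have h1 : F (Ω ∪ S t) - F (insert x (S t)) = X - δ := by simp only [X, δ]; ring
      have h2 : F (S k) - F (insert x (S t)) = F (S k) - F (S t) - δ := by simp only [δ]; ring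
      rw [h1, h2] at h
      have h3 := mul_le_mul_of_nonneg_right hXle (show 0 ≤ c - 1 + a by linarith)
      have h4 := mul_le_mul_of_nonneg_left hmain hX0
      have h5 : (m + 1) * (X * (1 - b)) ≤ (m + 1) * (c * (F (S k) - F (S t))) := by
        have := mul_le_mul_of_nonneg_left h (show (0 : ℝ) ≤ m + 1 by linarith)
        linarith
      exact le_of_mul_le_mul_left h5 (by linarith)
    · have hx' : x ∉ Ω ∪ S t := by simp [hxΩ, hx]
      have hcard : #(Ω \ S (t + 1)) ≤ m + 1 :=
        (card_le_card (sdiff_subset_sdiff subset_rfl (hS ▸ subset_insert x (S t)))).trans hn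
      have h := ih (m + 1) (t + 1) (by omega) (by omega) hcard
      have hsing : δ ≤ F {x} := by
        have := hsub ∅ (S t) (empty_subset _) x hx
        rw [hF0] at this
        simpa [hδ] using this
      have hnew : (1 - c) * δ ≤ F (insert x (Ω ∪ S t)) - F (Ω ∪ S t) := by
        have hsubset : Ω ∪ S t ⊆ univ.erase x :=
          fun y hy => mem_erase.2 ⟨fun h => hx' (h ▸ hy), mem_univ _⟩
        have h1 := hsub _ _ hsubset x (notMem_erase _ _)
        rw [insert_erase (mem_univ x)] at h1
        have h2 := mul_le_mul_of_nonneg_left hsing (sub_nonneg.2 hc1)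
        linarith [hcurv x]
      rw [hS, union_insert] at h
      push_cast at h
      have hpow1 : (1 - c / ((m : ℝ) + 1)) ^ r ≤ 1 := pow_le_one₀ hB0 hB1
      have hpow0 : 0 ≤ (1 - c / ((m : ℝ) + 1)) ^ r := pow_nonneg hB0 r
      have hcX : c / (m + 1) * (F (Ω ∪ S t) - F (S t)) ≤ c * δ := by
        rw [div_mul_eq_mul_div, div_le_iff₀ (by linarith)]
        linarith [mul_le_mul_of_nonneg_left hXle hc0]
      rw [pow_succ]
      set X := F (Ω ∪ S t) - F (S t)
      set p := (1 - c / ((m : ℝ) + 1)) ^ r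
      have h2 : F (S k) - F (insert x (S t)) = F (S k) - F (S t) - δ := by simp only [δ]; ring
      have h1 : X - c * δ ≤ F (insert x (Ω ∪ S t)) - F (insert x (S t)) := by
        simp only [X, δ] at hnew ⊢; linarith
      rw [h2] at h
      have h3 := mul_le_mul_of_nonneg_right h1 (sub_nonneg.2 hpow1)
      have h4 := mul_le_mul_of_nonneg_right hcX hpow0
      linarith

/-- The Conforti–Cornuéjols guarantee for the greedy algorithm. -/
theorem greedy_guarantee_of_curvature [Fintype ι] {c : ℝ} (hc0 : 0 < c) (hc1 : c ≤ 1)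
    (hF0 : F ∅ = 0)
    (hsub : ∀ A B : Finset ι, A ⊆ B → ∀ x ∉ B, F (insert x B) - F B ≤ F (insert x A) - F A)
    (hmono : ∀ A : Finset ι, ∀ x ∉ A, 0 ≤ F (insert x A) - F A)
    (hcurv : ∀ x, (1 - c) * F {x} ≤ F univ - F (univ.erase x))
    {k : ℕ} (hk : 1 ≤ k) {S : ℕ → Finset ι} (hS0 : S 0 = ∅)
    (hgreedy : ∀ t < k, ∃ x ∉ S t, S (t + 1) = insert x (S t) ∧
      ∀ y ∉ S t, F (insert y (S t)) - F (S t) ≤ F (insert x (S t)) - F (S t))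
    (Ω : Finset ι) (hΩ : #Ω ≤ k) (hFΩ : 0 ≤ F Ω) :
    (1 - Real.exp (-c)) / c * F Ω ≤ F (S k) := by
  have h := greedy_progress_of_curvature hc0.le hc1 hF0 hsub hmono hcurv hgreedy Ω k k 0
    (by omega) le_rfl (by simpa [hS0] using hΩ)
  rw [hS0, union_empty, hF0, sub_zero, sub_zero] at h
  have hexp : (1 - c / (k : ℝ)) ^ k ≤ Real.exp (-c) :=
    Real.one_sub_div_pow_le_exp_neg (hc1.trans (by exact_mod_cast hk))
  rw [div_mul_eq_mul_div, div_le_iff₀ hc0]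
  nlinarith

end Curvature

section LogDet

variable {n : Type*} [Fintype n] [DecidableEq n]

theorem Matrix.PosDef.two_mul_dotProduct_sub_le {A : Matrix n n ℝ} (hA : A.PosDef) (g v : n → ℝ) :
    2 * (g ⬝ᵥ v) - v ⬝ᵥ (A *ᵥ v) ≤ g ⬝ᵥ (A⁻¹ *ᵥ g) := by
  have hdet : IsUnit A.det := (Matrix.isUnit_iff_isUnit_det A).1 hA.isUnit
  set u := A⁻¹ *ᵥ g with hu
  have hAu : A *ᵥ u = g := by rw [hu, mulVec_mulVec, mul_nonsing_inv A hdet, one_mulVec]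
  have hsymm : u ⬝ᵥ (A *ᵥ v) = g ⬝ᵥ v := by
    have hT : Aᵀ = A := by simpa using hA.isHermitian.eq
    rw [dotProduct_mulVec, ← mulVec_transpose, hT, hAu]
  have h := hA.posSemidef.dotProduct_mulVec_nonneg (u - v)
  rw [star_trivial, mulVec_sub, sub_dotProduct, dotProduct_sub, dotProduct_sub, hAu, hsymm,
    dotProduct_comm u g, dotProduct_comm v g] at h
  linarith

theorem Matrix.PosDef.dotProduct_inv_mulVec_le {A B : Matrix n n ℝ} (hA : A.PosDef)
    (hB : B.PosDef) (hAB : ∀ v, v ⬝ᵥ (A *ᵥ v) ≤ v ⬝ᵥ (B *ᵥ v)) (g : n → ℝ) :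
    g ⬝ᵥ (B⁻¹ *ᵥ g) ≤ g ⬝ᵥ (A⁻¹ *ᵥ g) := by
  have hdet : IsUnit B.det := (Matrix.isUnit_iff_isUnit_det B).1 hB.isUnit
  have h1 := hA.two_mul_dotProduct_sub_le g (B⁻¹ *ᵥ g)
  have h2 := hAB (B⁻¹ *ᵥ g)
  rw [mulVec_mulVec _ B, mul_nonsing_inv B hdet, one_mulVec, dotProduct_comm _ g] at h2
  linarith

theorem Matrix.PosDef.log_det_add_smul_vecMulVec {A : Matrix n n ℝ} (hA : A.PosDef) (g : n → ℝ)
    {α : ℝ} (hα : 0 ≤ α) :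
    Real.log (A + α • vecMulVec g g).det - Real.log A.det =
      Real.log (1 + α * (g ⬝ᵥ (A⁻¹ *ᵥ g))) := by
  have hdet : IsUnit A.det := (Matrix.isUnit_iff_isUnit_det A).1 hA.isUnit
  have hq : 0 ≤ g ⬝ᵥ (A⁻¹ *ᵥ g) := by simpa using hA.inv.posSemidef.dotProduct_mulVec_nonneg g
  have h : (A + α • vecMulVec g g).det = A.det * (1 + α * (g ⬝ᵥ (A⁻¹ *ᵥ g))) := by
    rw [← smul_vecMulVec, vecMulVec_eq Unit, det_add_replicateCol_mul_replicateRow hdet]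
    congr 1
    rw [det_unique, add_apply, Matrix.mul_assoc, ← replicateCol_mulVec,
      replicateRow_mul_replicateCol_apply, mulVec_smul, dotProduct_smul, smul_eq_mul, one_apply_eq]
  rw [h, Real.log_mul hA.det_pos.ne' (by positivity)]
  ring

end LogDet

section Fisher

variable {ι : Type*} [DecidableEq ι] {d : ℕ} (g : ι → Fin d → ℝ) {α : ℝ}

theorem dotProduct_fisherMatrix_mulVec (S : Finset ι) (v : Fin d → ℝ) :
    v ⬝ᵥ (fisherMatrix g S *ᵥ v) = ∑ y ∈ S, (v ⬝ᵥ g y) ^ 2 := by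
  rw [fisherMatrix, sum_mulVec, dotProduct_sum]
  refine sum_congr rfl fun y _ => ?_
  rw [vecMulVec_mulVec, op_smul_eq_smul, dotProduct_smul, smul_eq_mul, dotProduct_comm (g y) v, sq]

theorem dotProduct_one_add_smul_fisherMatrix_mulVec (S : Finset ι) (v : Fin d → ℝ) :
    v ⬝ᵥ ((1 + α • fisherMatrix g S) *ᵥ v) = v ⬝ᵥ v + α * ∑ y ∈ S, (v ⬝ᵥ g y) ^ 2 := by
  rw [add_mulVec, one_mulVec, smul_mulVec, dotProduct_add, dotProduct_smul, smul_eq_mul,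
    dotProduct_fisherMatrix_mulVec]

theorem posDef_one_add_smul_fisherMatrix (hα : 0 ≤ α) (S : Finset ι) :
    (1 + α • fisherMatrix g S).PosDef := by
  refine PosDef.one.add_posSemidef (PosSemidef.smul ?_ hα)
  exact posSemidef_sum _ fun y _ => by simpa using posSemidef_vecMulVec_self_star (g y)

theorem fisherUtility_empty : fisherUtility g α ∅ = 0 := by
  simp [fisherUtility, fisherMatrix]

theorem fisherUtility_insert_sub (hα : 0 ≤ α) {S : Finset ι} {x : ι} (hx : x ∉ S) :
    fisherUtility g α (insert x S) - fisherUtility g α S =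
      Real.log (1 + α * (g x ⬝ᵥ ((1 + α • fisherMatrix g S)⁻¹ *ᵥ g x))) := by
  rw [← (posDef_one_add_smul_fisherMatrix g hα S).log_det_add_smul_vecMulVec (g x) hα]
  simp only [fisherUtility, fisherMatrix]
  rw [sum_insert hx, smul_add, add_comm (α • vecMulVec (g x) (g x)), ← add_assoc]

theorem fisherUtility_singleton (hα : 0 ≤ α) (x : ι) :
    fisherUtility g α {x} = Real.log (1 + α * (g x ⬝ᵥ g x)) := by
  have h := fisherUtility_insert_sub g hα (notMem_empty x)
  rw [fisherUtility_empty, sub_zero] at h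
  simpa [fisherMatrix] using h

theorem dotProduct_inv_fisher_mulVec_nonneg (hα : 0 ≤ α) (S : Finset ι) (v : Fin d → ℝ) :
    0 ≤ v ⬝ᵥ ((1 + α • fisherMatrix g S)⁻¹ *ᵥ v) := by
  simpa using (posDef_one_add_smul_fisherMatrix g hα S).inv.posSemidef.dotProduct_mulVec_nonneg v

theorem fisherUtility_gain_nonneg (hα : 0 ≤ α) {S : Finset ι} {x : ι} (hx : x ∉ S) :
    0 ≤ fisherUtility g α (insert x S) - fisherUtility g α S := by
  rw [fisherUtility_insert_sub g hα hx]
  have := mul_nonneg hα (dotProduct_inv_fisher_mulVec_nonneg g hα S (g x))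
  exact Real.log_nonneg (by linarith)

theorem fisherUtility_submodular (hα : 0 ≤ α) {S T : Finset ι} (hST : S ⊆ T) {x : ι}
    (hx : x ∉ T) :
    fisherUtility g α (insert x T) - fisherUtility g α T ≤
      fisherUtility g α (insert x S) - fisherUtility g α S := by
  rw [fisherUtility_insert_sub g hα hx, fisherUtility_insert_sub g hα fun h => hx (hST h)]
  have hT := mul_nonneg hα (dotProduct_inv_fisher_mulVec_nonneg g hα T (g x))
  refine Real.log_le_log (by linarith) (add_le_add_right (mul_le_mul_of_nonneg_left ?_ hα) 1)
  refine (posDef_one_add_smul_fisherMatrix g hα S).dotProduct_inv_mulVec_le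
    (posDef_one_add_smul_fisherMatrix g hα T) (fun v => ?_) (g x)
  simp only [dotProduct_one_add_smul_fisherMatrix_mulVec]
  gcongr

theorem dotProduct_mulVec_le_matOpNorm_mul (A : Matrix (Fin d) (Fin d) ℝ) (v : Fin d → ℝ) :
    v ⬝ᵥ (A *ᵥ v) ≤ matOpNorm A * (v ⬝ᵥ v) := by
  have hv : ‖WithLp.toLp 2 v‖ * ‖WithLp.toLp 2 v‖ = v ⬝ᵥ v := by
    rw [← real_inner_self_eq_norm_mul_norm, EuclideanSpace.inner_toLp_toLp, star_trivial]
  rw [← hv, matOpNorm]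
  calc v ⬝ᵥ (A *ᵥ v)
      = inner ℝ (WithLp.toLp 2 v) (toEuclideanCLM (𝕜 := ℝ) A (WithLp.toLp 2 v)) :=
        (inner_toEuclideanCLM A _ _).symm
    _ ≤ ‖WithLp.toLp 2 v‖ * ‖toEuclideanCLM (𝕜 := ℝ) A (WithLp.toLp 2 v)‖ :=
        real_inner_le_norm _ _
    _ ≤ ‖WithLp.toLp 2 v‖ * (‖toEuclideanCLM (𝕜 := ℝ) A‖ * ‖WithLp.toLp 2 v‖) := by
        gcongr
        exact ContinuousLinearMap.le_opNorm _ _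
    _ = _ := by ring

/-- The relative loss of the marginal gain of `x` on top of `S` is controlled by the alignment of
`g x` with the gradients in `S`. -/
theorem fisherUtility_singleton_sub_gain_le (hα : 0 ≤ α) {ρ : ℝ} (hρ0 : 0 ≤ ρ) (hρ1 : ρ < 1)
    {S : Finset ι} {x : ι} (hx : x ∉ S) (hS : α * matOpNorm (fisherMatrix g S) ≤ ρ) :
    fisherUtility g α {x} - (fisherUtility g α (insert x S) - fisherUtility g α S) ≤
      1 / (1 - ρ) * (α ^ 2 * ∑ y ∈ S, (g x ⬝ᵥ g y) ^ 2) / (1 + α * (g x ⬝ᵥ g x)) := by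
  rw [fisherUtility_singleton g hα, fisherUtility_insert_sub g hα hx]
  set s := g x ⬝ᵥ g x
  set q := g x ⬝ᵥ ((1 + α • fisherMatrix g S)⁻¹ *ᵥ g x)
  set T := ∑ y ∈ S, (g x ⬝ᵥ g y) ^ 2
  have hs0 : 0 ≤ s := by simpa using dotProduct_star_self_nonneg (g x)
  have hT0 : 0 ≤ T := sum_nonneg fun _ _ => sq_nonneg _
  have hq0 : 0 ≤ q := dotProduct_inv_fisher_mulVec_nonneg g hα S (g x)
  have hq : s - α * T ≤ q := by
    have h := (posDef_one_add_smul_fisherMatrix g hα S).two_mul_dotProduct_sub_le (g x) (g x)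
    rw [dotProduct_one_add_smul_fisherMatrix_mulVec] at h
    linarith
  have hTs : α * T ≤ ρ * s := by
    have h := dotProduct_mulVec_le_matOpNorm_mul (fisherMatrix g S) (g x)
    rw [dotProduct_fisherMatrix_mulVec] at h
    have h1 := mul_le_mul_of_nonneg_left h hα
    have h2 := mul_le_mul_of_nonneg_right hS hs0
    linarith
  have hs1 : 0 < 1 + α * s := by positivity
  have hq1 : 0 < 1 + α * q := by positivity
  have hρ : 0 < 1 - ρ := sub_pos.2 hρ1
  have hlow : (1 - ρ) * (1 + α * s) ≤ 1 + α * q := by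
    have : α * (s - ρ * s) ≤ α * q := mul_le_mul_of_nonneg_left (by linarith) hα
    linarith
  calc Real.log (1 + α * s) - Real.log (1 + α * q)
      = Real.log ((1 + α * s) / (1 + α * q)) := (Real.log_div hs1.ne' hq1.ne').symm
    _ ≤ (1 + α * s) / (1 + α * q) - 1 := Real.log_le_sub_one_of_pos (by positivity)
    _ = α * (s - q) / (1 + α * q) := by field_simp; ring
    _ ≤ α * (α * T) / (1 + α * q) := by gcongr; linarith
    _ ≤ α * (α * T) / ((1 - ρ) * (1 + α * s)) := by gcongr
    _ = _ := by field_simp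

end Fisher

/-- Data-dependent approximation guarantee: with
`C = 1/(1 − ρ − α G_max² ρ)` and the data-dependent curvature surrogate
`ĉ = max_x [C α² ∑_{y≠x} (gₓᵀ g_y)²] / [(1 + α‖gₓ‖²) log(1 + α‖gₓ‖²)]`,
if `0 < ĉ ≤ 1` then greedy with budget `k` on the Fisher utility satisfies
`F(S_greedy) ≥ ((1 − e^{−ĉ})/ĉ) · F(S*)`. -/
theorem fisher_greedy_data_dependent_guarantee
    {ι : Type*} [Fintype ι] [DecidableEq ι] [Nonempty ι] {d : ℕ} (hd : 1 ≤ d)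
    (g : ι → (Fin d → ℝ)) (hg : ∀ i : ι, g i ≠ 0)
    (α : ℝ) (hα : 0 < α)
    (Gmax ρ : ℝ) (hG : 0 < Gmax) (hρ0 : 0 < ρ) (hρ1 : ρ < 1)
    (hGbound : ∀ x : ι, Real.sqrt (g x ⬝ᵥ g x) ≤ Gmax)
    (hFS : ∀ S : Finset ι, α * matOpNorm (fisherMatrix g S) ≤ ρ)
    (hden : 0 < 1 - ρ - α * Gmax ^ 2 * ρ)
    (C : ℝ) (hC : C = 1 / (1 - ρ - α * Gmax ^ 2 * ρ))
    (chat : ℝ)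
    (hchat : chat = ⨆ x : ι,
      (C * α ^ 2 * ∑ y ∈ Finset.univ.erase x, (g x ⬝ᵥ g y) ^ 2) /
        ((1 + α * (g x ⬝ᵥ g x)) * Real.log (1 + α * (g x ⬝ᵥ g x))))
    (hchat0 : 0 < chat) (hchat1 : chat ≤ 1)
    (k : ℕ) (hk : 1 ≤ k)
    (S : ℕ → Finset ι) (hS0 : S 0 = ∅)
    (hgreedy : ∀ t < k, ∃ x ∉ S t, S (t + 1) = insert x (S t) ∧
      ∀ y ∉ S t,
        fisherUtility g α (insert y (S t)) - fisherUtility g α (S t) ≤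
          fisherUtility g α (insert x (S t)) - fisherUtility g α (S t))
    (Sstar : Finset ι) (hcard : Sstar.card ≤ k)
    (hopt : ∀ T : Finset ι, T.card ≤ k → fisherUtility g α T ≤ fisherUtility g α Sstar) :
    fisherUtility g α (S k) ≥
      ((1 - Real.exp (-chat)) / chat) * fisherUtility g α Sstar := by
  refine greedy_guarantee_of_curvature hchat0 hchat1 (fisherUtility_empty g)
    (fun A B hAB x hx => fisherUtility_submodular g hα.le hAB hx)
    (fun A x hx => fisherUtility_gain_nonneg g hα.le hx) (fun x => ?_) hk hS0 hgreedy Sstar hcard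
    (by simpa [fisherUtility_empty] using hopt ∅ (by simp))
  have hs : 0 < g x ⬝ᵥ g x := by simpa using dotProduct_star_self_pos_iff.2 (hg x)
  have hs1 : 0 < 1 + α * (g x ⬝ᵥ g x) := by positivity
  have hlog : 0 < Real.log (1 + α * (g x ⬝ᵥ g x)) :=
    Real.log_pos (by linarith [mul_pos hα hs])
  have hsup := le_ciSup (Set.finite_range fun x : ι =>
    (C * α ^ 2 * ∑ y ∈ Finset.univ.erase x, (g x ⬝ᵥ g y) ^ 2) /
      ((1 + α * (g x ⬝ᵥ g x)) * Real.log (1 + α * (g x ⬝ᵥ g x)))).bddAbove x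
  rw [← hchat, ← div_div, div_le_iff₀ hlog, ← fisherUtility_singleton g hα.le] at hsup
  have hloss := fisherUtility_singleton_sub_gain_le g hα.le hρ0.le hρ1
    (notMem_erase x univ) (hFS _)
  rw [insert_erase (mem_univ x)] at hloss
  have hCρ : 1 / (1 - ρ) ≤ C := by
    rw [hC]
    exact one_div_le_one_div_of_le hden (by linarith [show 0 ≤ α * Gmax ^ 2 * ρ by positivity])
  have hmid : 1 / (1 - ρ) * (α ^ 2 * ∑ y ∈ univ.erase x, (g x ⬝ᵥ g y) ^ 2) /
      (1 + α * (g x ⬝ᵥ g x)) ≤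
      C * α ^ 2 * (∑ y ∈ univ.erase x, (g x ⬝ᵥ g y) ^ 2) / (1 + α * (g x ⬝ᵥ g x)) := by
    rw [mul_assoc C]
    gcongr
  linarith
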